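/- arXiv:2301.09691 — 2 statements merged into one kernel-verified Lean document; each statement's English description precedes it below -/
import Mathlib

section
/- Let T be a set of primes, let A be a ℤ[T⁻¹]-module (every prime p ∈ T acts invertibly on A), and let B be an abelian group that is derived T-complete, i.e. B ≅ Ext¹(ℤ[T⁻¹]/ℤ, B) and Hom(ℤ[T⁻¹], B) = 0. Then Hom(A, B) = 0 and Ext¹(A, B) = 0. -/
open CategoryTheory

/-- `ℤ[T⁻¹]`: the subring of `ℚ` generated by the inverses of the primes in `T`. -/
def ZInv (T : Set ℕ) : Subring ℚ :=
  Subring.closure {x : ℚ | ∃ p ∈ T, x = (p : ℚ)⁻¹}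

/-- The quotient abelian group `ℤ[T⁻¹]/ℤ`. -/
def ZInvModZ (T : Set ℕ) : Type :=
  ZInv T ⧸ (Int.castAddHom (ZInv T)).range

instance (T : Set ℕ) : AddCommGroup (ZInvModZ T) :=
  QuotientAddGroup.Quotient.addCommGroup _

/-- `Ext¹(A, B)` in the category of abelian groups (`ℤ`-modules). -/
noncomputable def Ext1 (A B : Type) [AddCommGroup A] [AddCommGroup B] : Type :=
  ((Ext ℤ (ModuleCat ℤ) 1).obj (Opposite.op (ModuleCat.of ℤ A))).obj (ModuleCat.of ℤ B)

noncomputable instance (A B : Type) [AddCommGroup A] [AddCommGroup B] :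
    AddCommGroup (Ext1 A B) :=
  inferInstanceAs (AddCommGroup
    (((Ext ℤ (ModuleCat ℤ) 1).obj (Opposite.op (ModuleCat.of ℤ A))).obj (ModuleCat.of ℤ B)))


lemma aux_lift {k : Type} [CommRing k]
    {L X Y : Type*} [AddCommGroup L] [AddCommGroup X] [AddCommGroup Y]
    [Module k L] [Module k X] [Module k Y] [Module.Projective k L]
    (v : X →ₗ[k] Y) (u : L →ₗ[k] Y) (h : ∀ l, ∃ x, v x = u l) :
    ∃ w : L →ₗ[k] X, ∀ l, v (w l) = u l := by
  obtain ⟨w, hw⟩ := Module.projective_lifting_property v.rangeRestrict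
    (u.codRestrict (LinearMap.range v) (fun l => h l)) v.surjective_rangeRestrict
  exact ⟨w, fun l => congrArg Subtype.val (LinearMap.congr_fun hw l)⟩

lemma aux_desc {k : Type} [CommRing k] 
    {P M Y : Type*} [AddCommGroup P] [AddCommGroup M] [AddCommGroup Y]
    [Module k P] [Module k M] [Module k Y]
    (q : P →ₗ[k] M) (hq : Function.Surjective q) (u : P →ₗ[k] Y)
    (h : ∀ x, q x = 0 → u x = 0) : ∃ w : M →ₗ[k] Y, ∀ x, w (q x) = u x := by
  refine ⟨((LinearMap.ker q).liftQ u (fun x hx => h x hx)).comp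
    (q.quotKerEquivOfSurjective hq).symm.toLinearMap, fun x => ?_⟩
  have : (q.quotKerEquivOfSurjective hq).symm (q x) = (LinearMap.ker q).mkQ x := by
    rw [LinearEquiv.symm_apply_eq]; rfl
  simp only [LinearMap.comp_apply, LinearEquiv.coe_coe, this]
  rfl

lemma aux_core {k : Type} [CommRing k]
    {F S P N B I J : Type} [AddCommGroup F] [AddCommGroup S] [AddCommGroup P]
    [AddCommGroup N] [AddCommGroup B] [AddCommGroup I] [AddCommGroup J]
    [Module k F] [Module k S] [Module k P] [Module k N] [Module k B] [Module k I] [Module k J]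
    [Module.Projective k F] [Module.Flat k S] [Module.Projective k P]
    [Module.Injective k I] [Module.Injective k J]
    (q : F →ₗ[k] S) [Module.Projective k (LinearMap.ker q)] (hq : Function.Surjective q)
    (p : P →ₗ[k] N) (hp : Function.Surjective p)
    (ι : B →ₗ[k] I) (hι : Function.Injective ι) (c : I →ₗ[k] J) (hc : Function.Surjective c)
    (hex : Function.Exact ι c)
    (π : (LinearMap.ker p →ₗ[k] B) →ₗ[k] B) (hπ : Function.Surjective π)
    (hπ0 : ∀ d : P →ₗ[k] B, π (d.comp (LinearMap.ker p).subtype) = 0)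
    (g : LinearMap.ker q →ₗ[k] B) : ∃ h : F →ₗ[k] B, ∀ l : LinearMap.ker q, h l = g l := by
  obtain ⟨g1, hg1⟩ := aux_lift π g (fun l => hπ _)
  obtain ⟨g2, hg2⟩ := aux_lift (LinearMap.lcomp k I (LinearMap.ker p).subtype)
    ((LinearMap.llcomp k (LinearMap.ker p) B I ι).comp g1) (fun l => by
      obtain ⟨x, hx⟩ := Module.Injective.out (LinearMap.ker p).subtype
        (Submodule.injective_subtype _) (ι.comp (g1 l))
      exact ⟨x, LinearMap.ext hx⟩)
  have hg2' : ∀ l (k : LinearMap.ker p), g2 l k = ι (g1 l k) := fun l k =>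
    LinearMap.congr_fun (hg2 l) k
  obtain ⟨g3, hg3⟩ := aux_lift (LinearMap.lcomp k J p)
    ((LinearMap.llcomp k P I J c).comp g2) (fun l => by
      obtain ⟨w, hw⟩ := aux_desc p hp (c.comp (g2 l)) (fun x hx => by
        have := hg2' l ⟨x, hx⟩
        simp only at this
        simp [this, hex.apply_apply_eq_zero])
      exact ⟨w, LinearMap.ext hw⟩)
  have hg3' : ∀ l x, g3 l (p x) = c (g2 l x) := fun l x => LinearMap.congr_fun (hg3 l) x
  obtain ⟨t, ht⟩ := Module.Injective.out ((LinearMap.ker q).subtype.lTensor N)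
    (LinearMap.lTensor_injective_of_exact_of_flat q hq _ (Submodule.injective_subtype _)
      (by rw [LinearMap.exact_iff]; simp) N) (TensorProduct.lift g3.flip)
  obtain ⟨g5, hg5⟩ := aux_lift (LinearMap.llcomp k P I J c)
    ((LinearMap.lcomp k J p).comp (TensorProduct.curry t).flip) (fun f => by
      obtain ⟨w, hw⟩ := aux_lift c (((TensorProduct.curry t).flip f).comp p) (fun x => hc _)
      exact ⟨w, LinearMap.ext hw⟩)
  have hg5' : ∀ f x, c (g5 f x) = t (p x ⊗ₜ f) := fun f x => LinearMap.congr_fun (hg5 f) x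
  have hB : ∀ (Z : Type) [AddCommGroup Z] [Module k Z] (u : Z →ₗ[k] I), (∀ z, c (u z) = 0) →
      ∃ w : Z →ₗ[k] B, ∀ z, ι (w z) = u z := by
    intro Z _ _ u hu
    let e := LinearEquiv.ofInjective ι hι
    refine ⟨e.symm.toLinearMap.comp (u.codRestrict (LinearMap.range ι)
      (fun z => (hex _).1 (hu z))), fun z => ?_⟩
    have := e.apply_symm_apply ⟨u z, (hex _).1 (hu z)⟩
    exact congrArg Subtype.val this
  obtain ⟨g6, hg6⟩ := aux_lift (LinearMap.llcomp k (LinearMap.ker p) B I ι)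
    ((LinearMap.lcomp k I (LinearMap.ker p).subtype).comp g5) (fun f => by
      obtain ⟨w, hw⟩ := hB _ ((g5 f).comp (LinearMap.ker p).subtype) (fun z => by
        have : p z = 0 := z.2
        simp [hg5', this])
      exact ⟨w, LinearMap.ext hw⟩)
  have hg6' : ∀ f (k : LinearMap.ker p), ι (g6 f k) = g5 f k := fun f k =>
    LinearMap.congr_fun (hg6 f) k
  refine ⟨π.comp g6, fun l => ?_⟩
  obtain ⟨d, hd⟩ := hB _ (g5 l - g2 l) (fun x => by
    have := ht (p x ⊗ₜ l)
    simp at this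
    simp [hg5', ← hg3', this])
  have : g6 l - g1 l = d.comp (LinearMap.ker p).subtype := by
    ext k
    apply hι
    simp [hd, hg6', hg2']
  have h2 := hπ0 d
  rw [← this, map_sub, sub_eq_zero, hg1] at h2
  exact h2

/-- lifting along `c` gives extension -/
lemma aux_ext {k : Type} [CommRing k]
    {P M B I J : Type} [AddCommGroup P]
    [AddCommGroup M] [AddCommGroup B] [AddCommGroup I] [AddCommGroup J]
    [Module k P] [Module k M] [Module k B] [Module k I] [Module k J]
    [Module.Injective k I]
    (p : P →ₗ[k] M) (hp : Function.Surjective p)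
    (ι : B →ₗ[k] I) (hι : Function.Injective ι) (c : I →ₗ[k] J)
    (hex : Function.Exact ι c)
    (H : ∀ ψ : M →ₗ[k] J, ∃ χ : M →ₗ[k] I, ∀ m, c (χ m) = ψ m)
    (g : LinearMap.ker p →ₗ[k] B) : ∃ h : P →ₗ[k] B, ∀ l : LinearMap.ker p, h l = g l := by
  obtain ⟨x, hx⟩ := Module.Injective.out (LinearMap.ker p).subtype
        (Submodule.injective_subtype _) (ι.comp g)
  obtain ⟨ψ, hψ⟩ := aux_desc p hp (c.comp x) (fun z hz => by
    have := hx ⟨z, hz⟩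
    simp at this
    simp [this, hex.apply_apply_eq_zero])
  obtain ⟨χ, hχ⟩ := H ψ
  let e := LinearEquiv.ofInjective ι hι
  have hu : ∀ z, c ((x - χ.comp p) z) = 0 := fun z => by simp [hχ, hψ]
  refine ⟨e.symm.toLinearMap.comp ((x - χ.comp p).codRestrict (LinearMap.range ι)
      (fun z => (hex _).1 (hu z))), fun l => hι ?_⟩
  have h1 := congrArg Subtype.val
    (e.apply_symm_apply ⟨(x - χ.comp p) l, (hex _).1 (hu l)⟩)
  have hl : p l = 0 := l.2
  have h2 := hx l
  refine Eq.trans h1 ?_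
  simp at h2
  simp [hl, h2]

lemma aux_lift_of_ext {k : Type} [CommRing k]
    {P M B I J : Type} [AddCommGroup P]
    [AddCommGroup M] [AddCommGroup B] [AddCommGroup I] [AddCommGroup J]
    [Module k P] [Module k M] [Module k B] [Module k I] [Module k J]
    [Module.Projective k P]
    (p : P →ₗ[k] M) (hp : Function.Surjective p)
    (ι : B →ₗ[k] I) (hι : Function.Injective ι) (c : I →ₗ[k] J) (hc : Function.Surjective c)
    (hex : Function.Exact ι c)
    (H : ∀ g : LinearMap.ker p →ₗ[k] B, ∃ h : P →ₗ[k] B, ∀ l : LinearMap.ker p, h l = g l)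
    (ψ : M →ₗ[k] J) : ∃ χ : M →ₗ[k] I, ∀ m, c (χ m) = ψ m := by
  obtain ⟨x, hx⟩ := aux_lift c (ψ.comp p) (fun z => hc _)
  let e := LinearEquiv.ofInjective ι hι
  have hu : ∀ z : LinearMap.ker p, c ((x.comp (LinearMap.ker p).subtype) z) = 0 := fun z => by
    have hl : p z = 0 := z.2
    simp [hx, hl]
  obtain ⟨h, hh⟩ := H (e.symm.toLinearMap.comp
    ((x.comp (LinearMap.ker p).subtype).codRestrict (LinearMap.range ι)
      (fun z => (hex _).1 (hu z))))
  have h1 : ∀ z : LinearMap.ker p, ι (h z) = x z := fun z => by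
    rw [hh]
    exact congrArg Subtype.val
      (e.apply_symm_apply ⟨(x.comp (LinearMap.ker p).subtype) z, (hex _).1 (hu z)⟩)
  obtain ⟨χ, hχ⟩ := aux_desc p hp (x - ι.comp h) (fun z hz => by
    have := h1 ⟨z, hz⟩
    simp at this
    simp [this])
  refine ⟨χ, fun m => ?_⟩
  obtain ⟨z, rfl⟩ := hp m
  simp [hχ, hx, hex.apply_apply_eq_zero]

lemma aux_inj0 (X : Type) [AddCommGroup X] [Module ℤ X] :
    ∃ (I : Type) (_ : AddCommGroup I) (_ : Module ℤ I)
    (ι : X →ₗ[ℤ] I), Module.Injective ℤ I ∧ Function.Injective ι := by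
  obtain ⟨p⟩ := EnoughInjectives.presentation (ModuleCat.of ℤ X)
  have hI : Module.Injective ℤ p.J := by
    have := p.injective
    exact Module.injective_module_of_injective_object ℤ p.J
  exact ⟨p.J, inferInstance, inferInstance, p.f.hom, hI,
    (ModuleCat.mono_iff_injective p.f).1 p.mono⟩

lemma aux_div {k : Type} [CommRing k] (I : Type) [AddCommGroup I] [Module k I]
    [hI : Module.Injective k I] (n : k) (hn : IsRegular n) (x : I) : ∃ y : I, n • y = x := by
  obtain ⟨h, hh⟩ := Module.Injective.out (LinearMap.mulLeft k n)
      (fun a b hab => hn.left hab) (LinearMap.toSpanSingleton k I x)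
  refine ⟨h 1, ?_⟩
  have := hh 1
  simp only [LinearMap.mulLeft_apply, LinearMap.toSpanSingleton_apply, one_smul] at this
  rw [← this, ← map_smul, smul_eq_mul]

lemma aux_inj (X : Type) [AddCommGroup X] [Module ℤ X] (Z : Submodule ℤ X) :
    ∃ (I J : Type) (_ : AddCommGroup I)
    (_ : AddCommGroup J) (_ : Module ℤ I) (_ : Module ℤ J)
    (ι : X →ₗ[ℤ] I) (c : I →ₗ[ℤ] J), Module.Injective ℤ I ∧
    Module.Injective ℤ J ∧ Function.Injective ι ∧ Function.Surjective c ∧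
    ∀ i, c i = 0 ↔ ∃ z ∈ Z, ι z = i := by
  obtain ⟨I, _, inst, ι, hI, hι⟩ := aux_inj0 X
  obtain rfl : inst = AddCommGroup.toIntModule I := Subsingleton.elim _ _
  let W : AddSubgroup I := (Z.map ι).toAddSubgroup
  let c : I →+ I ⧸ W := QuotientAddGroup.mk' W
  have hc : Function.Surjective c := QuotientAddGroup.mk'_surjective _
  let _ : DivisibleBy (I ⧸ W) ℤ := divisibleByOfSMulRightSurj (I ⧸ W) ℤ (by
    intro n hn x
    obtain ⟨y, rfl⟩ := hc x
    obtain ⟨z, hz⟩ := aux_div I n (IsRegular.of_ne_zero hn) y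
    refine ⟨c z, ?_⟩
    rw [← hz]
    exact (map_zsmul c n z).symm)
  have hJ : Module.Injective ℤ (I ⧸ W) := (Module.Baer.of_divisible (I ⧸ W)).injective
  refine ⟨I, I ⧸ W, inferInstance, inferInstance, inferInstance, inferInstance, ι,
    c.toIntLinearMap, hI, hJ, hι, hc, fun i => ?_⟩
  exact (QuotientAddGroup.eq_zero_iff i).trans Iff.rfl

lemma aux_proj {k : Type} [CommRing k]
    (hQ : ∀ (X : Type) [AddCommGroup X] [Module k X] (Z : Submodule k X),
    ∃ (I J : Type) (_ : AddCommGroup I)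
    (_ : AddCommGroup J) (_ : Module k I) (_ : Module k J)
    (ι : X →ₗ[k] I) (c : I →ₗ[k] J), Module.Injective k I ∧
    Module.Injective k J ∧ Function.Injective ι ∧ Function.Surjective c ∧
    ∀ i, c i = 0 ↔ ∃ z ∈ Z, ι z = i)
    (F : Type) [AddCommGroup F] [Module k F] [Module.Projective k F] (K : Submodule k F) :
    Module.Projective k K := by
  let f : (K →₀ k) →ₗ[k] K := Finsupp.linearCombination k id
  have hf : Function.Surjective f := Finsupp.linearCombination_id_surjective k _
  obtain ⟨I, J, _, _, _, _, j, c, hI, hJ, hj, hc, hex⟩ := hQ (K →₀ k) (LinearMap.ker f)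
  obtain ⟨u, hu⟩ := aux_desc f hf (c.comp j) (fun x hx => (hex _).2 ⟨x, hx, rfl⟩)
  obtain ⟨u', hu'⟩ := Module.Injective.out K.subtype (Submodule.injective_subtype _) u
  obtain ⟨v, hv⟩ := aux_lift c u' (fun l => hc _)
  have key : ∀ y : K, ∃ x, j x = v y ∧ f x = y := by
    intro y
    obtain ⟨x, rfl⟩ := hf y
    have h1 : c (v (f x) - j x) = 0 := by
      have := hu' (f x)
      simp only [Submodule.subtype_apply] at this
      rw [map_sub, hv, this, hu]; simp
    obtain ⟨z, hz, hz'⟩ := (hex _).1 h1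
    refine ⟨x + z, by rw [map_add, hz']; abel, ?_⟩
    have : f z = 0 := hz
    rw [map_add, this, add_zero]
  choose w hw hfw using key
  let W : K →ₗ[k] (K →₀ k) :=
    { toFun := w
      map_add' := fun a b => hj (by simp [hw])
      map_smul' := fun a b => hj (by simp [hw]) }
  exact Module.Projective.of_split W f (LinearMap.ext hfw)

lemma bridge {k : Type} [CommRing k] (M B : Type) [AddCommGroup M] [AddCommGroup B]
      [Module k M] [Module k B] :
    ∃ (P : Type) (_ : AddCommGroup P) (_ : Module k P) (q : P →ₗ[k] M)
      (π : (LinearMap.ker q →ₗ[k] B) →ₗ[k]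
        ((Ext k (ModuleCat k) 1).obj (Opposite.op (ModuleCat.of k M))).obj (ModuleCat.of k B)),
      Module.Projective k P ∧
      Function.Surjective q ∧ Function.Surjective π ∧
      ∀ d : P →ₗ[k] B, π (d.comp (LinearMap.ker q).subtype) = 0 := by
  let R := ProjectiveResolution.of (ModuleCat.of k M)
  let Y := ModuleCat.of k B
  let D := R.complex.linearYonedaObj k Y
  let S := D.sc' 0 1 2
  let e : ((Ext k (ModuleCat k) 1).obj (Opposite.op (ModuleCat.of k M))).obj Y ≅
     S.moduleCatLeftHomologyData.H := R.isoExt 1 Y ≪≫ 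
      D.homologyIsoSc' 0 1 2 (by simp) (by simp) ≪≫ S.moduleCatHomologyIso
  let q : R.complex.X 0 →ₗ[k] M := (R.π.f 0).hom
  have hq : Function.Surjective q := (ModuleCat.epi_iff_surjective (R.π.f 0)).1 inferInstance
  have h0 := R.exact₀
  have h1 := R.exact_succ 0
  rw [ShortComplex.moduleCat_exact_iff] at h0 h1
  have hP : Module.Projective k (R.complex.X 0) :=
    (IsProjective.iff_projective _).2 (R.projective 0)
  have hd : ∀ x, q ((R.complex.d 1 0).hom x) = 0 := by
    intro x
    have := R.complex_d_comp_π_f_zero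
    exact ConcreteCategory.congr_hom this x
  let d1 : R.complex.X 1 →ₗ[k] LinearMap.ker q := (R.complex.d 1 0).hom.codRestrict _ hd
  have hd1 : Function.Surjective d1 := by
    rintro ⟨x, hx⟩
    obtain ⟨y, hy⟩ := h0 x hx
    exact ⟨y, Subtype.ext hy⟩
  let z : (LinearMap.ker q →ₗ[k] B) →ₗ[k] LinearMap.ker S.g.hom :=
    { toFun := fun f => ⟨ModuleCat.ofHom (f.comp d1), by
        show R.complex.d 2 1 ≫ ModuleCat.ofHom (f.comp d1) = 0
        ext x
        have h : d1 ((R.complex.d 2 1).hom x) = 0 :=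
          Subtype.ext (ConcreteCategory.congr_hom (R.complex.d_comp_d 2 1 0) x)
        show f (d1 ((R.complex.d 2 1).hom x)) = 0
        rw [h, map_zero]⟩
      map_add' := fun f g => rfl
      map_smul' := fun f g => rfl }
  refine ⟨R.complex.X 0, inferInstance, inferInstance, q,
    e.inv.hom.comp (S.moduleCatLeftHomologyData.π.hom.comp z), hP, hq, ?_, ?_⟩
  · have he : Function.Surjective e.inv.hom := (ModuleCat.epi_iff_surjective e.inv).1 inferInstance
    have hπ : Function.Surjective S.moduleCatLeftHomologyData.π.hom :=
      Submodule.mkQ_surjective _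
    have hz : Function.Surjective z := by
      rintro ⟨f, hf⟩
      have hf' : R.complex.d 2 1 ≫ (show R.complex.X 1 ⟶ Y from f) = 0 := hf
      let f'' : R.complex.X 1 ⟶ Y := f
      let f' : R.complex.X 1 →ₗ[k] B := f''.hom
      obtain ⟨w, hw⟩ := aux_desc d1 hd1 f' (fun x hx => by
        obtain ⟨y, hy⟩ := h1 x (congrArg Subtype.val hx)
        have := ConcreteCategory.congr_hom hf' y
        rw [← hy]
        exact this)
      refine ⟨w, Subtype.ext ?_⟩
      have : ModuleCat.ofHom (w.comp d1) = f'' := ModuleCat.hom_ext (LinearMap.ext hw)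
      exact this
    exact he.comp (hπ.comp hz)
  · intro d
    have : z (d.comp (LinearMap.ker q).subtype) ∈ LinearMap.range S.moduleCatToCycles :=
      ⟨ModuleCat.ofHom d, rfl⟩
    have h2 : S.moduleCatLeftHomologyData.π.hom (z (d.comp (LinearMap.ker q).subtype)) = 0 :=
      (Submodule.Quotient.mk_eq_zero _).2 this
    show e.inv.hom (S.moduleCatLeftHomologyData.π.hom (z (d.comp (LinearMap.ker q).subtype))) = 0
    rw [h2, map_zero]

lemma aux_restr {k : Type} [CommRing k] {P M B : Type} [AddCommGroup P]
    [AddCommGroup M] [AddCommGroup B] [Module k P] [Module k M] [Module k B]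
    (p : P →ₗ[k] M) (g : LinearMap.ker p →ₗ[k] B) (h : P →ₗ[k] B)
    (hh : ∀ l : LinearMap.ker p, h l = g l) : g = h.comp (LinearMap.ker p).subtype :=
  LinearMap.ext fun l => (hh l).symm

lemma aux_act (T : Set ℕ) (hT : ∀ p ∈ T, Nat.Prime p) {A : Type} [AddCommGroup A]
    (hA : ∀ p ∈ T, Function.Bijective (fun a : A => p • a)) :
    ∃ φ : A → (ZInv T →+ A), (∀ a, φ a 1 = a) ∧ ∀ a b x, φ (a + b) x = φ a x + φ b x := by
  have key : ∀ x : ZInv T, ∃ (m : ℤ) (n : ℤ), m ≠ 0 ∧ Function.Bijective (fun a : A => m • a) ∧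
      (x : ℚ) * m = n := by
    rintro ⟨x, hx⟩
    simp only
    refine Subring.closure_induction (p := fun x _ => ∃ (m : ℤ) (n : ℤ), m ≠ 0 ∧
      Function.Bijective (fun a : A => m • a) ∧ (x : ℚ) * m = n) ?_ ?_ ?_ ?_ ?_ ?_ hx
    · rintro _ ⟨p, hp, rfl⟩
      have := (hT p hp).ne_zero
      refine ⟨p, 1, by exact_mod_cast this, by simpa using hA p hp, ?_⟩
      have : (p : ℚ) ≠ 0 := by exact_mod_cast this
      simp [this]
    · exact ⟨1, 0, one_ne_zero, by simpa using! Function.bijective_id, by simp⟩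
    · exact ⟨1, 1, one_ne_zero, by simpa using! Function.bijective_id, by simp⟩
    · rintro x y _ _ ⟨m, n, hm, hb, h⟩ ⟨m', n', hm', hb', h'⟩
      refine ⟨m * m', n * m' + n' * m, mul_ne_zero hm hm', ?_, ?_⟩
      · simpa only [mul_smul] using! hb.comp hb'
      · push_cast
        rw [← h, ← h']; ring
    · rintro x _ ⟨m, n, hm, hb, h⟩
      exact ⟨m, -n, hm, hb, by push_cast; rw [← h]; ring⟩
    · rintro x y _ _ ⟨m, n, hm, hb, h⟩ ⟨m', n', hm', hb', h'⟩
      refine ⟨m * m', n * n', mul_ne_zero hm hm', ?_, ?_⟩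
      · simpa only [mul_smul] using! hb.comp hb'
      · push_cast
        rw [← h, ← h']; ring
  choose m n hm hb hx using key
  choose f hf using fun (a : A) (x : ZInv T) => (hb x).2 (n x • a)
  simp only at hf
  have huniq : ∀ (a : A) (x : ZInv T) (M N : ℤ), (x : ℚ) * M = N → M • f a x = N • a := by
    intro a x M N h
    apply (hb x).1
    simp only
    rw [smul_comm, hf, smul_smul, smul_smul]
    congr 1
    have : ((M * n x : ℤ) : ℚ) = (m x * N : ℤ) := by
      push_cast
      rw [← h, ← hx]; ring
    exact_mod_cast this
  refine ⟨fun a => ⟨⟨f a, ?_⟩, ?_⟩, ?_, ?_⟩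
  · have := huniq a 0 1 0 (by simp)
    simpa using this
  · intro x y
    simp only
    apply ((hb x).comp (hb y)).1
    simp only [Function.comp, smul_add]
    rw [smul_comm (m x) (m y) (f a x), hf, hf, smul_smul, huniq a (x + y) _ (n x * m y + n y * m x),
      smul_smul, smul_smul, ← add_smul]
    · congr 1; ring
    · push_cast
      rw [← hx, ← hx]; ring
  · intro a
    have := huniq a 1 1 1 (by simp)
    simpa using this
  · intro a b x
    apply (hb x).1
    show m x • f (a + b) x = m x • (f a x + f b x)
    simp only [smul_add, hf]

/-- if every prime `p ∈ T` acts invertibly on `A` (so `A` is a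
`ℤ[T⁻¹]`-module), and `B` is derived `T`-complete, i.e. `B ≅ Ext¹(ℤ[T⁻¹]/ℤ, B)` and
`Hom(ℤ[T⁻¹], B) = 0`, then `Hom(A, B) = 0` and `Ext¹(A, B) = 0`. -/
theorem stmt4 (T : Set ℕ) (hT : ∀ p ∈ T, Nat.Prime p)
    {A B : Type} [AddCommGroup A] [AddCommGroup B]
    (hA : ∀ p ∈ T, Function.Bijective (fun a : A => p • a))
    (hB1 : Nonempty (B ≃+ Ext1 (ZInvModZ T) B))
    (hB2 : ∀ g : (ZInv T) →+ B, g = 0) :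
    (∀ f : A →+ B, f = 0) ∧ Subsingleton (Ext1 A B) := by


  obtain ⟨φ, hφ1, hφadd⟩ := aux_act T hT hA
  refine ⟨fun f => ?_, ?_⟩
  · ext a
    have := DFunLike.congr_fun (hB2 (f.comp (φ a))) 1
    simpa [hφ1] using this
  obtain ⟨I, J, _, _, _, _, ι, c, hI, hJ, hι, hc, hex0⟩ := aux_inj B ⊤
  have hex : Function.Exact ι c := fun i => (hex0 i).trans (by simp)
  have hS1 : ∀ ψ : ZInv T →ₗ[ℤ] J, ∃ χ : ZInv T →ₗ[ℤ] I, ∀ m, c (χ m) = ψ m := by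
    obtain ⟨P, _, _, p, π, hP, hp, hπ, hπ0⟩ := bridge (k := ℤ) (ZInvModZ T) B
    obtain ⟨e⟩ := hB1
    let e' : ((Ext ℤ (ModuleCat ℤ) 1).obj (Opposite.op (ModuleCat.of ℤ (ZInvModZ T)))).obj
      (ModuleCat.of ℤ B) →+ B := e.symm.toAddMonoidHom
    have he' : Function.Surjective e' := e.symm.surjective
    let e'' : ((Ext ℤ (ModuleCat ℤ) 1).obj (Opposite.op (ModuleCat.of ℤ (ZInvModZ T)))).obj
      (ModuleCat.of ℤ B) →ₗ[ℤ] B :=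
      { e' with map_smul' := fun n x => by simpa using map_intCast_smul e' ℤ ℤ n x }
    have hq : Function.Surjective (Finsupp.linearCombination ℤ (id : ZInv T → ZInv T)) :=
      Finsupp.linearCombination_id_surjective ℤ _
    have := aux_proj aux_inj _ (LinearMap.ker (Finsupp.linearCombination ℤ (id : ZInv T → ZInv T)))
    exact aux_lift_of_ext _ hq ι hι c hc hex (aux_core _ hq p hp ι hι c hc hex (e''.comp π)
      (he'.comp hπ) (fun d => by
        show e'' (π _) = 0
        exact (congrArg e'' (hπ0 d)).trans (map_zero e'')))
  have hS1u : ∀ χ χ' : ZInv T →ₗ[ℤ] I, (∀ x, c (χ x) = c (χ' x)) → ∀ x, χ x = χ' x := by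
    intro χ χ' h x
    have h' : ∀ x, ∃ b, ι b = χ x - χ' x := fun x => (hex _).1 (by simp [h])
    choose g hg using h'
    have := hB2 ⟨⟨g, hι (by simp [hg])⟩, fun x y => hι (by simp [hg]; abel)⟩
    have h2 : g x = 0 := DFunLike.congr_fun this x
    have := hg x
    rw [h2, map_zero] at this
    exact (sub_eq_zero.1 this.symm)
  have hS2 : ∀ ψ : A →ₗ[ℤ] J, ∃ χ : A →ₗ[ℤ] I, ∀ m, c (χ m) = ψ m := by
    intro ψ
    choose χ hχ using fun a => hS1 (ψ.comp (φ a).toIntLinearMap)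
    have hχ' : ∀ a x, c (χ a x) = ψ (φ a x) := hχ
    let X : A →+ I := AddMonoidHom.mk' (fun a => χ a 1) (fun a b => 
      hS1u (χ (a + b)) (χ a + χ b) (fun x => by simp [hχ', hφadd]) 1)
    refine ⟨{ X with map_smul' := fun n x => by simpa using map_intCast_smul X ℤ ℤ n x },
      fun a => ?_⟩
    show c (χ a 1) = ψ a
    rw [hχ', hφ1]
  obtain ⟨P, _, _, p, π, hP, hp, hπ, hπ0⟩ := bridge (k := ℤ) A B
  refine ⟨fun x y => ?_⟩
  have hz : ∀ x : Ext1 A B, x = (0 : ((Ext ℤ (ModuleCat ℤ) 1).obj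
      (Opposite.op (ModuleCat.of ℤ A))).obj (ModuleCat.of ℤ B)) := by
    intro x
    obtain ⟨g, rfl⟩ := hπ x
    obtain ⟨h, hh⟩ := aux_ext p hp ι hι c hex hS2 g
    exact (congrArg π (aux_restr p g h hh)).trans (hπ0 h)
  rw [hz x, hz y]
end

section
/- Let F : ℕ → Type be a sequence of topological spaces with closed embeddings F n ↪ F (n+1), and suppose each inclusion induces an isomorphism on singular homology with coefficients in an abelian group M. Then the inclusion F 0 → colim F induces an isomorphism on singular homology with M coefficients in all degrees. -/
open CategoryTheory

/-- The singular chain complex of a topological space, with `ℤ` coefficients. -/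
noncomputable def singularChains : TopCat ⥤ ChainComplex (ModuleCat ℤ) ℕ :=
  TopCat.toSSet ⋙ ((SimplicialObject.whiskering _ _).obj (ModuleCat.free ℤ)) ⋙
    AlgebraicTopology.alternatingFaceMapComplex (ModuleCat ℤ)

/-- Singular homology with coefficients in the abelian group `M`, as a functor
`TopCat ⥤ ModuleCat ℤ`: the homology of `C_*(X; ℤ) ⊗ M`. -/
noncomputable def singularHomology (M : Type) [AddCommGroup M] (n : ℕ) :
    TopCat ⥤ ModuleCat ℤ :=
  singularChains ⋙
    (MonoidalCategory.tensorRight (ModuleCat.of ℤ M)).mapHomologicalComplex _ ⋙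
    HomologicalComplex.homologyFunctor _ _ n

open CategoryTheory Limits


namespace Stmt11

section Topo
variable (F : ℕ ⥤ TopCat.{0}) 

lemma closedEmb (hcl : ∀ n : ℕ, Topology.IsClosedEmbedding (F.map (homOfLE (Nat.le_succ n))))
    {m n : ℕ} (f : m ⟶ n) : Topology.IsClosedEmbedding (F.map f) := by
  obtain ⟨k, rfl⟩ := Nat.exists_eq_add_of_le (leOfHom f)
  induction k with
  | zero =>
    have : f = 𝟙 _ := Subsingleton.elim _ _
    rw [this, F.map_id]
    exact Topology.IsClosedEmbedding.id
  | succ k ih =>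
    have : f = homOfLE (Nat.le_add_right m k) ≫ homOfLE (Nat.le_succ (m+k)) :=
      Subsingleton.elim _ _
    rw [this, F.map_comp]
    exact (hcl (m+k)).comp (ih _)

lemma ι_jsurj (x : (colimit F : TopCat.{0})) : ∃ n, ∃ y : F.obj n, colimit.ι F n y = x :=
  Concrete.isColimit_exists_rep F (colimit.isColimit F) x

lemma ι_eq {i j : ℕ} (x : F.obj i) (y : F.obj j) (h : colimit.ι F i x = colimit.ι F j y) :
    ∃ (k : ℕ) (f : i ⟶ k) (g : j ⟶ k), F.map f x = F.map g y :=
  Concrete.isColimit_exists_of_rep_eq F (colimit.isColimit F) x y h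

lemma ι_w {i j : ℕ} (f : i ⟶ j) (x : F.obj i) :
    colimit.ι F j (F.map f x) = colimit.ι F i x := by
  rw [← colimit.w F f]; rfl

lemma ι_inj (hcl : ∀ n : ℕ, Topology.IsClosedEmbedding (F.map (homOfLE (Nat.le_succ n)))) (n : ℕ) :
    Function.Injective (colimit.ι F n) := by
  intro x y h
  obtain ⟨k, f, g, h⟩ := ι_eq F x y h
  obtain rfl : f = g := Subsingleton.elim _ _
  exact (closedEmb F hcl f).injective h

lemma isClosed_iff (S : Set (colimit F : TopCat.{0})) :
    IsClosed S ↔ ∀ n, IsClosed (colimit.ι F n ⁻¹' S) :=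
  TopCat.isClosed_iff_of_isColimit _ (colimit.isColimit F) S

lemma ι_closedEmb
    (hcl : ∀ n : ℕ, Topology.IsClosedEmbedding (F.map (homOfLE (Nat.le_succ n)))) (n : ℕ) :
    Topology.IsClosedEmbedding (colimit.ι F n) := by
  refine Topology.IsClosedEmbedding.of_continuous_injective_isClosedMap
    (colimit.ι F n).hom.continuous (ι_inj F hcl n) ?_
  intro C hC
  rw [isClosed_iff]
  intro m
  rcases le_total n m with h | h
  · convert (closedEmb F hcl (homOfLE h)).isClosedMap C hC using 1
    ext y
    constructor
    · rintro ⟨x, hx, hxy⟩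
      refine ⟨x, hx, ι_inj F hcl m ?_⟩
      rw [ι_w, ← hxy]
    · rintro ⟨x, hx, rfl⟩
      exact ⟨x, hx, (ι_w F _ x).symm⟩
  · convert hC.preimage (F.map (homOfLE h)).hom.continuous using 1
    ext y
    constructor
    · rintro ⟨x, hx, hxy⟩
      rw [← ι_w F (homOfLE h) y] at hxy
      have := ι_inj F hcl n hxy
      subst this
      exact hx
    · intro hy
      exact ⟨_, hy, ι_w F _ y⟩

lemma factor (hT1 : ∀ n : ℕ, T1Space (F.obj n))
    (hcl : ∀ n : ℕ, Topology.IsClosedEmbedding (F.map (homOfLE (Nat.le_succ n))))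
    {K : Type*} [TopologicalSpace K] [CompactSpace K]
    (f : K → (colimit F : TopCat.{0})) (hf : Continuous f) :
    ∃ n, ∀ x, f x ∈ Set.range (colimit.ι F n) := by
  by_contra! H
  choose x hx using H
  have mono : ∀ {m n : ℕ}, m ≤ n → Set.range (colimit.ι F m) ⊆ Set.range (colimit.ι F n) := by
    rintro m n h _ ⟨y, rfl⟩
    exact ⟨F.map (homOfLE h) y, ι_w F _ y⟩
  let A : ℕ → Set (colimit F : TopCat.{0}) := fun n => (fun k => f (x k)) '' Set.Ici n
  have hA : ∀ n, IsClosed (A n) := by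
    intro n
    rw [isClosed_iff]
    intro m
    have := hT1 m
    apply Set.Finite.isClosed
    refine Set.Finite.subset (Set.Finite.preimage (ι_inj F hcl m).injOn
      ((Set.finite_Iio m).image (fun k => f (x k)))) ?_
    rintro y ⟨k, -, hk⟩
    refine ⟨k, ?_, hk⟩
    by_contra hkm
    exact hx k (mono (not_lt.1 hkm) ⟨y, hk.symm⟩)
  obtain ⟨z, hz⟩ := IsCompact.nonempty_iInter_of_sequence_nonempty_isCompact_isClosed
    (fun n => f ⁻¹' (A n))
    (fun n => Set.preimage_mono (Set.image_mono (Set.Ici_subset_Ici.2 (Nat.le_succ n))))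
    (fun n => ⟨x n, n, Set.self_mem_Ici, rfl⟩)
    ((hA 0).preimage hf).isCompact (fun n => (hA n).preimage hf)
  obtain ⟨m, y, hy⟩ := ι_jsurj F (f z)
  obtain ⟨k, hk, hkz⟩ := Set.mem_iInter.1 hz m
  exact hx k (mono hk ⟨y, hy.trans hkz.symm⟩)

lemma factorHom (hT1 : ∀ n : ℕ, T1Space (F.obj n))
    (hcl : ∀ n : ℕ, Topology.IsClosedEmbedding (F.map (homOfLE (Nat.le_succ n))))
    {K : TopCat.{0}} [CompactSpace K] (f : K ⟶ colimit F) :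
    ∃ n, ∃ g : K ⟶ F.obj n, g ≫ colimit.ι F n = f := by
  obtain ⟨n, hn⟩ := factor F hT1 hcl f f.hom.continuous
  choose g hg using hn
  refine ⟨n, TopCat.ofHom ⟨g, ?_⟩, ?_⟩
  · rw [(ι_closedEmb F hcl n).isInducing.continuous_iff]
    convert f.hom.continuous using 1
    exact funext hg
  · ext x
    exact hg x

lemma preserves_eval (hT1 : ∀ n : ℕ, T1Space (F.obj n))
    (hcl : ∀ n : ℕ, Topology.IsClosedEmbedding (F.map (homOfLE (Nat.le_succ n))))
    (k : SimplexCategoryᵒᵖ) :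
    PreservesColimit F (TopCat.toSSet ⋙ (evaluation _ _).obj k) := by
  refine preservesColimit_of_preserves_colimit_cocone (colimit.isColimit F) ?_
  refine Types.FilteredColimit.isColimitOf' _ _ ?_ ?_
  · rintro ⟨x⟩
    have : CompactSpace (SimplexCategory.toTop.{0}.obj k.unop) := by
      change CompactSpace (ULift (stdSimplex ℝ (Fin (k.unop.len + 1))))
      infer_instance
    obtain ⟨n, g, hg⟩ := factorHom F hT1 hcl (K := SimplexCategory.toTop.{0}.obj k.unop) x
    exact ⟨n, ⟨g⟩, congrArg ULift.up hg.symm⟩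
  · rintro n ⟨x⟩ ⟨y⟩ h
    refine ⟨n, 𝟙 _, ?_⟩
    change SimplexCategory.toTop.{0}.obj k.unop ⟶ F.obj n at x y
    have h : x ≫ colimit.ι F n = y ≫ colimit.ι F n := congrArg ULift.down h
    have : x = y := by
      ext t
      exact ι_inj F hcl n (ConcreteCategory.congr_hom h t)
    rw [this]
end Topo

lemma exists_cycle (S : ShortComplex (ModuleCat.{0} ℤ)) (x : S.X₂) (hx : S.g x = 0) :
    ∃ z : S.cycles, S.iCycles z = x := by
  have := S.moduleCatCyclesIso_inv_iCycles
  exact ⟨S.moduleCatCyclesIso.inv ⟨x, hx⟩, ConcreteCategory.congr_hom this _⟩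

lemma π_eq_zero_iff (S : ShortComplex (ModuleCat.{0} ℤ)) (z : S.cycles) :
    S.homologyπ z = 0 ↔ ∃ y : S.X₁, S.f y = S.iCycles z := by
  have hex : (ShortComplex.mk S.toCycles S.homologyπ (by simp)).Exact :=
    ShortComplex.exact_of_g_is_cokernel _ S.homologyIsCokernel
  have inj : Function.Injective S.iCycles := (ModuleCat.mono_iff_injective _).1 inferInstance
  have hc : ∀ y, S.iCycles (S.toCycles y) = S.f y := fun y =>
    ConcreteCategory.congr_hom S.toCycles_i y
  constructor
  · intro h
    obtain ⟨y, hy⟩ := (ShortComplex.moduleCat_exact_iff _).1 hex z h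
    exact ⟨y, by rw [← hc]; exact congrArg _ hy⟩
  · rintro ⟨y, hy⟩
    obtain rfl : S.toCycles y = z := inj (by rw [hc, hy])
    exact ConcreteCategory.congr_hom S.toCycles_comp_homologyπ y

lemma π_surj (S : ShortComplex (ModuleCat.{0} ℤ)) : Function.Surjective S.homologyπ :=
  (ModuleCat.epi_iff_surjective _).1 inferInstance

lemma map_i {S T : ShortComplex (ModuleCat.{0} ℤ)} (φ : S ⟶ T) (z : S.cycles) :
    T.iCycles (ShortComplex.cyclesMap φ z) = φ.τ₂ (S.iCycles z) :=
  ConcreteCategory.congr_hom (ShortComplex.cyclesMap_i φ) z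

lemma map_π {S T : ShortComplex (ModuleCat.{0} ℤ)} (φ : S ⟶ T) (z : S.cycles) :
    ShortComplex.homologyMap φ (S.homologyπ z) = T.homologyπ (ShortComplex.cyclesMap φ z) :=
  ConcreteCategory.congr_hom (ShortComplex.homologyπ_naturality φ) z

lemma comm12 {S T : ShortComplex (ModuleCat.{0} ℤ)} (φ : S ⟶ T) (z : S.X₁) :
    φ.τ₂ (S.f z) = T.f (φ.τ₁ z) :=
  (ConcreteCategory.congr_hom φ.comm₁₂ z).symm

lemma comm23 {S T : ShortComplex (ModuleCat.{0} ℤ)} (φ : S ⟶ T) (z : S.X₂) :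
    φ.τ₃ (S.g z) = T.g (φ.τ₂ z) :=
  (ConcreteCategory.congr_hom φ.comm₂₃ z).symm

lemma homology_isIso (S : ℕ ⥤ ShortComplex (ModuleCat.{0} ℤ)) (c : Cocone S)
    (h1 : IsColimit (ShortComplex.π₁.mapCocone c))
    (h2 : IsColimit (ShortComplex.π₂.mapCocone c))
    (h3 : IsColimit (ShortComplex.π₃.mapCocone c))
    (hiso : ∀ n, IsIso (ShortComplex.homologyMap (S.map (homOfLE (Nat.zero_le n))))) :
    IsIso (ShortComplex.homologyMap (c.ι.app 0)) := by
  have w : ∀ {m n : ℕ} (f : m ⟶ n), S.map f ≫ c.ι.app n = c.ι.app m := fun f => c.w f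
  rw [ConcreteCategory.isIso_iff_bijective]
  constructor
  · rw [injective_iff_map_eq_zero]
    intro a ha
    obtain ⟨z, rfl⟩ := π_surj _ a
    rw [map_π, π_eq_zero_iff] at ha
    obtain ⟨y, hy⟩ := ha
    rw [map_i] at hy
    obtain ⟨n, y', rfl⟩ : ∃ n, ∃ y' : (S.obj n).X₁, (c.ι.app n).τ₁ y' = y :=
      Concrete.isColimit_exists_rep _ h1 y
    rw [← comm12] at hy
    obtain ⟨m, f, g, hm⟩ : ∃ (m : ℕ) (f : n ⟶ m) (g : 0 ⟶ m),
        (S.map f).τ₂ ((S.obj n).f y') = (S.map g).τ₂ ((S.obj 0).iCycles z) :=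
      Concrete.isColimit_exists_of_rep_eq _ h2 _ _ hy
    have := hiso m
    apply (ConcreteCategory.bijective_of_isIso
      (ShortComplex.homologyMap (S.map (homOfLE (Nat.zero_le m))))).1
    rw [map_zero, map_π, π_eq_zero_iff]
    refine ⟨(S.map f).τ₁ y', ?_⟩
    rw [← comm12, hm, map_i]
    rfl
  · intro a
    obtain ⟨z, rfl⟩ := π_surj _ a
    obtain ⟨n, x, hx⟩ : ∃ n, ∃ x : (S.obj n).X₂, (c.ι.app n).τ₂ x = c.pt.iCycles z :=
      Concrete.isColimit_exists_rep _ h2 _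
    have h0 : (c.ι.app n).τ₃ ((S.obj n).g x) = (c.ι.app n).τ₃ 0 := by
      rw [comm23, hx, map_zero]
      exact ConcreteCategory.congr_hom c.pt.iCycles_g z
    obtain ⟨m, f, g, hm⟩ : ∃ (m : ℕ) (f : n ⟶ m) (g : n ⟶ m),
        (S.map f).τ₃ ((S.obj n).g x) = (S.map g).τ₃ 0 :=
      Concrete.isColimit_exists_of_rep_eq _ h3 _ _ h0
    rw [comm23, map_zero] at hm
    obtain ⟨z', hz'⟩ := exists_cycle _ _ hm
    have := hiso m
    obtain ⟨b, hb⟩ := (ConcreteCategory.bijective_of_isIso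
      (ShortComplex.homologyMap (S.map (homOfLE (Nat.zero_le m))))).2 ((S.obj m).homologyπ z')
    refine ⟨b, ?_⟩
    rw [← w (homOfLE (Nat.zero_le m)), ShortComplex.homologyMap_comp, ConcreteCategory.comp_apply,
      hb, map_π]
    congr 1
    have inj : Function.Injective c.pt.iCycles := (ModuleCat.mono_iff_injective _).1 inferInstance
    apply inj
    rw [map_i, hz', ← hx, ← w f]
    rfl

noncomputable def chains (M : Type) [AddCommGroup M] : TopCat.{0} ⥤ ChainComplex (ModuleCat.{0} ℤ) ℕ :=
  singularChains ⋙
    (MonoidalCategory.tensorRight (ModuleCat.of ℤ M)).mapHomologicalComplex _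

lemma chains_preserves (M : Type) [AddCommGroup M] (F : ℕ ⥤ TopCat.{0})
    (hT1 : ∀ n : ℕ, T1Space (F.obj n))
    (hcl : ∀ n : ℕ, Topology.IsClosedEmbedding (F.map (homOfLE (Nat.le_succ n)))) (i : ℕ) :
    PreservesColimit F (chains M ⋙ HomologicalComplex.eval _ _ i) := by
  have := preserves_eval F hT1 hcl (Opposite.op (SimplexCategory.mk i))
  have h2 : PreservesColimitsOfShape ℕ (ModuleCat.free.{0} ℤ) :=
    (ModuleCat.adj.{0} ℤ).leftAdjoint_preservesColimits.preservesColimitsOfShape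
  have h3 : PreservesColimitsOfShape ℕ (MonoidalCategory.tensorRight (ModuleCat.of ℤ M)) :=
    inferInstance
  have h4 : PreservesColimit F ((TopCat.toSSet ⋙ (evaluation _ _).obj
      (Opposite.op (SimplexCategory.mk i))) ⋙ ModuleCat.free.{0} ℤ ⋙
        MonoidalCategory.tensorRight (ModuleCat.of ℤ M)) := inferInstance
  exact h4

end Stmt11

/-- given a sequence of T₁ spaces with closed embeddings `F n ↪ F (n+1)`, each
inducing isomorphisms on singular homology with coefficients in `M`, the inclusion of `F 0`
into the sequential colimit induces isomorphisms on singular homology with `M` coefficients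
in all degrees. -/
theorem stmt11 (M : Type) [AddCommGroup M] (F : ℕ ⥤ TopCat)
    (hT1 : ∀ n : ℕ, T1Space (F.obj n))
    (hcl : ∀ n : ℕ, Topology.IsClosedEmbedding (F.map (homOfLE (Nat.le_succ n))))
    (hiso : ∀ (n k : ℕ), IsIso ((singularHomology M k).map (F.map (homOfLE (Nat.le_succ n))))) :
    ∀ k : ℕ, IsIso ((singularHomology M k).map (colimit.ι F 0)) := by
  intro k
  let S : ℕ ⥤ ShortComplex (ModuleCat.{0} ℤ) :=
    F ⋙ Stmt11.chains M ⋙ HomologicalComplex.shortComplexFunctor _ _ k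
  let c : Cocone S :=
    (Stmt11.chains M ⋙ HomologicalComplex.shortComplexFunctor _ _ k).mapCocone (colimit.cocone F)
  have key : ∀ i, Nonempty (IsColimit
      ((Stmt11.chains M ⋙ HomologicalComplex.eval _ _ i).mapCocone (colimit.cocone F))) := by
    intro i
    have := Stmt11.chains_preserves M F hT1 hcl i
    exact ⟨isColimitOfPreserves _ (colimit.isColimit F)⟩
  refine Stmt11.homology_isIso S c (key _).some (key _).some (key _).some ?_
  intro n
  change IsIso ((singularHomology M k).map (F.map (homOfLE (Nat.zero_le n))))
  induction n with
  | zero =>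
    have : homOfLE (Nat.zero_le 0) = 𝟙 _ := Subsingleton.elim _ _
    rw [this, F.map_id]
    infer_instance
  | succ n ih =>
    have : homOfLE (Nat.zero_le (n + 1)) = homOfLE (Nat.zero_le n) ≫ homOfLE (Nat.le_succ n) :=
      Subsingleton.elim _ _
    rw [this, F.map_comp, Functor.map_comp]
    have := hiso n k
    infer_instance
end
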